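/- For (z,w) ∈ ℂ², define ν(z,w) = ( z·conj(w)/2 , (|z|² − |w|²)/4 ) ∈ ℂ × ℝ, where ℂ × ℝ carries the Euclidean norm ‖(a,b)‖ = √(|a|² + b²). Then: (i) for every (z,w) ∈ ℂ², ‖ν(z,w)‖ = (|z|² + |w|²)/4; and (ii) for all nonzero vectors (z,w), (z',w') ∈ ℂ², the equality ‖ν(z,w) + ν(z',w')‖ = ‖ν(z,w)‖ + ‖ν(z',w')‖ holds if and only if z·w' − z'·w = 0, i.e. if and only if (z,w) and (z',w') are ℂ-linearly dependent. -/

import Mathlib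

/-- The Hopf map `ν(z,w) = (z·conj(w)/2, (|z|²−|w|²)/4) ∈ ℂ × ℝ`. -/
noncomputable def hopfNu (z w : ℂ) : ℂ × ℝ :=
  (z * (starRingEnd ℂ) w / 2, (‖z‖ ^ 2 - ‖w‖ ^ 2) / 4)

/-- The Euclidean norm on `ℂ × ℝ`: `‖(a,b)‖ = √(|a|² + b²)`. -/
noncomputable def euclNorm (p : ℂ × ℝ) : ℝ :=
  Real.sqrt (‖p.1‖ ^ 2 + p.2 ^ 2)

theorem euclNorm_hopfNu (z w : ℂ) : euclNorm (hopfNu z w) = (‖z‖ ^ 2 + ‖w‖ ^ 2) / 4 := by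
  have h : ‖(hopfNu z w).1‖ ^ 2 + (hopfNu z w).2 ^ 2 = ((‖z‖ ^ 2 + ‖w‖ ^ 2) / 4) ^ 2 := by
    simp only [hopfNu, norm_div, norm_mul, RCLike.norm_conj, Complex.norm_ofNat]
    ring
  rw [euclNorm, h, Real.sqrt_sq (by positivity)]

theorem euclNorm_nonneg (p : ℂ × ℝ) : 0 ≤ euclNorm p :=
  Real.sqrt_nonneg _

theorem euclNorm_sq (p : ℂ × ℝ) : euclNorm p ^ 2 = ‖p.1‖ ^ 2 + p.2 ^ 2 :=
  Real.sq_sqrt (by positivity)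

/-- The defect in the triangle inequality for two Hopf images is the squared Plücker coordinate. -/
theorem euclNorm_hopfNu_add_sq (z w z' w' : ℂ) :
    euclNorm (hopfNu z w + hopfNu z' w') ^ 2 =
      (euclNorm (hopfNu z w) + euclNorm (hopfNu z' w')) ^ 2 - ‖z * w' - z' * w‖ ^ 2 / 4 := by
  have h : hopfNu z w + hopfNu z' w' =
      ((z * (starRingEnd ℂ) w + z' * (starRingEnd ℂ) w') / 2,
        (‖z‖ ^ 2 - ‖w‖ ^ 2 + (‖z'‖ ^ 2 - ‖w'‖ ^ 2)) / 4) := by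
    simp only [hopfNu, Prod.mk_add_mk, add_div]
  rw [euclNorm_sq, euclNorm_hopfNu, euclNorm_hopfNu, h]
  simp only [norm_div, div_pow, Complex.norm_ofNat, Complex.sq_norm, Complex.normSq_apply,
    Complex.add_re, Complex.add_im, Complex.sub_re, Complex.sub_im, Complex.mul_re,
    Complex.mul_im, Complex.conj_re, Complex.conj_im]
  ring

/-- (i) For every `(z,w) ∈ ℂ²`, `‖ν(z,w)‖ = (|z|² + |w|²)/4`; and (ii) for nonzero
`(z,w), (z',w') ∈ ℂ²`, equality `‖ν(z,w)+ν(z',w')‖ = ‖ν(z,w)‖ + ‖ν(z',w')‖` holds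
if and only if `z·w' − z'·w = 0`, i.e. iff `(z,w)` and `(z',w')` are linearly dependent. -/
theorem hopf_norm_and_parallel :
    (∀ z w : ℂ, euclNorm (hopfNu z w) = (‖z‖ ^ 2 + ‖w‖ ^ 2) / 4) ∧
    (∀ z w z' w' : ℂ, (z, w) ≠ (0, 0) → (z', w') ≠ (0, 0) →
      (euclNorm (hopfNu z w + hopfNu z' w') = euclNorm (hopfNu z w) + euclNorm (hopfNu z' w')
        ↔ z * w' - z' * w = 0)) := by
  refine ⟨euclNorm_hopfNu, fun z w z' w' _ _ => ?_⟩
  have h := euclNorm_hopfNu_add_sq z w z' w'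
  rw [← sq_eq_sq₀ (euclNorm_nonneg _) (add_nonneg (euclNorm_nonneg _) (euclNorm_nonneg _)),
    h, sub_eq_self, div_eq_zero_iff, or_iff_left four_ne_zero, sq_eq_zero_iff, norm_eq_zero]
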